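/- arXiv:2112.04022 — 7 statements merged into one kernel-verified Lean document; each statement's English description precedes it below -/
import Mathlib

section
/- Let n be a positive integer and let Φ be a linear map from n×n complex matrices to n×n complex matrices. Then Φ is trace-preserving (Tr(Φ(ρ)) = Tr(ρ) for all ρ) and completely positive (for every positive integer m and every positive semidefinite nm×nm matrix ρ, the matrix obtained by applying Φ ⊗ id_m to ρ is positive semidefinite) if and only if there exists a finite family of n×n complex matrices M_1, …, M_K with K ≤ n² such that Φ(ρ) = Σ_k M_k ρ M_k† for all ρ and Σ_k M_k† M_k = I. -/
open Matrix ComplexOrder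

/-- Entries of `∑ k, M k * ρ * (M k)ᴴ`, arranged along the matrix units. -/
lemma sum_mul_mul_conjTranspose_apply {ι n : Type*} [Fintype ι] [Fintype n]
    (M : ι → Matrix n n ℂ) (ρ : Matrix n n ℂ) (a b : n) :
    (∑ k, M k * ρ * (M k)ᴴ) a b = ∑ i, ∑ j, ρ i j * ∑ k, M k a i * star (M k b j) := by
  simp only [Matrix.sum_apply, Matrix.mul_apply, conjTranspose_apply, Finset.mul_sum,
    Finset.sum_mul]
  rw [Finset.sum_comm]
  conv_rhs => rw [Finset.sum_comm]
  refine Finset.sum_congr rfl fun j _ => ?_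
  rw [Finset.sum_comm]
  exact Finset.sum_congr rfl fun i _ => Finset.sum_congr rfl fun k _ => by ring

/-- Applying a Kraus family blockwise is conjugation by the matrices `M k ⊗ 1`. -/
lemma blockwise_sum_eq_sum_kroneckerMap {ι n m : Type*} [Fintype ι] [Fintype n] [Fintype m]
    [DecidableEq m] (M : ι → Matrix n n ℂ) (ρ : Matrix (n × m) (n × m) ℂ) :
    (of fun p q : n × m =>
        (∑ k, M k * (of fun a b : n => ρ (a, p.2) (b, q.2)) * (M k)ᴴ) p.1 q.1) =
      ∑ k, kroneckerMap (· * ·) (M k) (1 : Matrix m m ℂ) * ρ *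
        (kroneckerMap (· * ·) (M k) (1 : Matrix m m ℂ))ᴴ := by
  ext p q
  simp [Matrix.sum_apply, Matrix.mul_apply, Fintype.sum_prod_type, Matrix.one_apply, apply_ite]

lemma trace_sum_mul_mul_conjTranspose {ι n : Type*} [Fintype ι] [Fintype n]
    (M : ι → Matrix n n ℂ) (ρ : Matrix n n ℂ) :
    (∑ k, M k * ρ * (M k)ᴴ).trace = ((∑ k, (M k)ᴴ * M k) * ρ).trace := by
  rw [trace_sum, Finset.sum_mul, trace_sum]
  exact Finset.sum_congr rfl fun k _ => trace_mul_cycle _ _ _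

/-- The Choi matrix of a linear map of matrices. -/
def choiMatrix {n : Type*} [DecidableEq n] (Φ : Matrix n n ℂ →ₗ[ℂ] Matrix n n ℂ) :
    Matrix (n × n) (n × n) ℂ :=
  of fun p q => Φ (single p.2 q.2 1) p.1 q.1

lemma apply_eq_sum_choiMatrix {n : Type*} [Fintype n] [DecidableEq n]
    (Φ : Matrix n n ℂ →ₗ[ℂ] Matrix n n ℂ) (ρ : Matrix n n ℂ) (a b : n) :
    Φ ρ a b = ∑ i, ∑ j, ρ i j * choiMatrix Φ (a, i) (b, j) := by
  conv_lhs => rw [matrix_eq_sum_single ρ]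
  simp only [map_sum, Matrix.sum_apply]
  refine Finset.sum_congr rfl fun i _ => Finset.sum_congr rfl fun j _ => ?_
  rw [← mul_one (ρ i j), ← smul_eq_mul, ← smul_single, map_smul]
  simp [choiMatrix]

open scoped MatrixOrder Matrix.Norms.L2Operator in
/-- A map with positive semidefinite Choi matrix has a Kraus decomposition. -/
lemma exists_kraus_of_posSemidef_choiMatrix {n : Type*} [Fintype n] [DecidableEq n]
    (Φ : Matrix n n ℂ →ₗ[ℂ] Matrix n n ℂ) (h : (choiMatrix Φ).PosSemidef) :
    ∃ M : n × n → Matrix n n ℂ, ∀ ρ, Φ ρ = ∑ k, M k * ρ * (M k)ᴴ := by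
  obtain ⟨B, hB⟩ := CStarAlgebra.nonneg_iff_eq_mul_star_self.mp h.nonneg
  refine ⟨fun k => of fun a i => B (a, i) k, fun ρ => ?_⟩
  ext a b
  rw [sum_mul_mul_conjTranspose_apply, apply_eq_sum_choiMatrix, hB]
  rfl

/-- Choi–Kraus characterization of quantum channels: a linear map on n×n complex
matrices is trace-preserving and completely positive iff it admits a Kraus
decomposition with at most n² Kraus operators summing (as M†M) to the identity. -/
theorem stmt_0 (n : ℕ) (hn : 0 < n)
    (Φ : Matrix (Fin n) (Fin n) ℂ →ₗ[ℂ] Matrix (Fin n) (Fin n) ℂ) :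
    ((∀ ρ : Matrix (Fin n) (Fin n) ℂ, (Φ ρ).trace = ρ.trace) ∧
      ∀ m : ℕ, 0 < m → ∀ ρ : Matrix (Fin n × Fin m) (Fin n × Fin m) ℂ, ρ.PosSemidef →
        (Matrix.of fun p q : Fin n × Fin m =>
          Φ (Matrix.of fun a b : Fin n => ρ (a, p.2) (b, q.2)) p.1 q.1).PosSemidef) ↔
    ∃ (K : ℕ) (M : Fin K → Matrix (Fin n) (Fin n) ℂ),
      1 ≤ K ∧ K ≤ n ^ 2 ∧
      (∀ ρ, Φ ρ = ∑ k, M k * ρ * (M k)ᴴ) ∧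
      ∑ k, (M k)ᴴ * M k = 1 := by
  constructor
  · rintro ⟨htr, hcp⟩
    have hchoi : (choiMatrix Φ).PosSemidef := by
      convert hcp n hn _ (posSemidef_vecMulVec_self_star
        fun p : Fin n × Fin n => if p.1 = p.2 then (1 : ℂ) else 0) using 1
      ext p q
      simp only [choiMatrix, of_apply]
      refine congrArg (fun X => Φ X p.1 q.1) ?_
      ext a b
      simp [vecMulVec_apply, single_apply, apply_ite, ← ite_and, eq_comm, and_comm]
    obtain ⟨M, hM⟩ := exists_kraus_of_posSemidef_choiMatrix Φ hchoi
    have hsum : ∀ ρ, Φ ρ = ∑ k : Fin (n * n), M (finProdFinEquiv.symm k) * ρ *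
        (M (finProdFinEquiv.symm k))ᴴ := fun ρ => by
      rw [hM, ← finProdFinEquiv.symm.sum_comp]
    refine ⟨n * n, fun k => M (finProdFinEquiv.symm k), Nat.mul_pos hn hn, (sq n).ge, hsum, ?_⟩
    refine ext_iff_trace_mul_right.mpr fun ρ => ?_
    rw [← trace_sum_mul_mul_conjTranspose, ← hsum, htr, one_mul]
  · rintro ⟨K, M, -, -, hM, hone⟩
    refine ⟨fun ρ => ?_, fun m _ ρ hρ => ?_⟩
    · rw [hM, trace_sum_mul_mul_conjTranspose, hone, one_mul]
    · simp only [hM]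
      rw [blockwise_sum_eq_sum_kroneckerMap]
      exact posSemidef_sum _ fun k _ => hρ.mul_mul_conjTranspose_same _
end

section
/- Let P be an n×n complex orthogonal projector (P† = P and P·P = P), let M be an n×n complex matrix, and let c ≥ 0 be a real number such that P M† M P = c·P. Then there exists a unitary n×n matrix U such that M P = √c · U P. -/
open Matrix

/-- Two linear maps with the same pointwise norm into a finite-dimensional inner product space
differ by a linear isometry of the target. -/
theorem LinearMap.exists_linearIsometry_of_norm_eq {𝕜 E V : Type*} [RCLike 𝕜]
    [AddCommGroup E] [Module 𝕜 E] [NormedAddCommGroup V] [InnerProductSpace 𝕜 V]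
    [FiniteDimensional 𝕜 V] (f g : E →ₗ[𝕜] V) (h : ∀ x, ‖f x‖ = ‖g x‖) :
    ∃ L : V →ₗᵢ[𝕜] V, ∀ x, f x = L (g x) := by
  obtain ⟨s, hs⟩ := g.rangeRestrict.exists_rightInverse_of_surjective g.range_rangeRestrict
  have hgs (y : LinearMap.range g) : g (s y) = y :=
    congrArg Subtype.val (LinearMap.congr_fun hs y)
  let L₀ : LinearMap.range g →ₗᵢ[𝕜] V :=
    { toLinearMap := f ∘ₗ s
      norm_map' := fun y ↦ by
        rw [LinearMap.comp_apply, h, hgs, Submodule.coe_norm] }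
  refine ⟨L₀.extend, fun x ↦ ?_⟩
  have hL : L₀.extend (g x) = f (s (g.rangeRestrict x)) :=
    L₀.extend_apply (g.rangeRestrict x)
  rw [hL, ← sub_eq_zero, ← norm_eq_zero, ← map_sub, h, map_sub, hgs]
  simp

/-- Matrices with the same Gram matrix differ by a unitary factor on the left. -/
theorem Matrix.exists_unitary_mul_of_conjTranspose_mul_self_eq {𝕜 m n : Type*} [RCLike 𝕜]
    [Fintype m] [DecidableEq m] [Fintype n] [DecidableEq n] (A B : Matrix m n 𝕜)
    (h : Aᴴ * A = Bᴴ * B) : ∃ U ∈ Matrix.unitaryGroup m 𝕜, A = U * B := by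
  have norm_sq (C : Matrix m n 𝕜) (x : EuclideanSpace 𝕜 n) :
      ‖C.toEuclideanLin x‖ ^ 2 = RCLike.re (inner 𝕜 x ((Cᴴ * C).toEuclideanLin x)) := by
    rw [Matrix.toEuclideanLin, Matrix.toLpLin_mul 2 2 2, LinearMap.comp_apply,
      Matrix.toEuclideanLin_conjTranspose_eq_adjoint, LinearMap.adjoint_inner_right,
      inner_self_eq_norm_sq]
  obtain ⟨L, hL⟩ := LinearMap.exists_linearIsometry_of_norm_eq A.toEuclideanLin B.toEuclideanLin
    fun x ↦ by rw [← sq_eq_sq₀ (norm_nonneg _) (norm_nonneg _), norm_sq, norm_sq, h]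
  let b := EuclideanSpace.basisFun m 𝕜
  refine ⟨(L.toLinearIsometryEquiv rfl).toMatrix b.toBasis b.toBasis,
    LinearIsometryEquiv.toMatrix_mem_unitaryGroup _ b b, ?_⟩
  apply Matrix.toEuclideanLin.injective
  ext1 x
  rw [hL, Matrix.toEuclideanLin, Matrix.toLpLin_mul 2 2 2, LinearMap.comp_apply]
  exact (LinearMap.congr_fun (Matrix.toLin_toMatrix b.toBasis b.toBasis L.toLinearMap) _).symm

/-- Polar-decomposition step of the Knill–Laflamme sufficiency proof: if
P M† M P = c P with P an orthogonal projector and c ≥ 0, then there is a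
unitary U with M P = √c · U P. -/
theorem stmt_2 (n : ℕ) (P M : Matrix (Fin n) (Fin n) ℂ)
    (hP1 : Pᴴ = P) (hP2 : P * P = P) (c : ℝ) (hc : 0 ≤ c)
    (h : P * Mᴴ * M * P = (c : ℂ) • P) :
    ∃ U : Matrix (Fin n) (Fin n) ℂ, U ∈ Matrix.unitaryGroup (Fin n) ℂ ∧
      M * P = (Real.sqrt c : ℂ) • (U * P) := by
  obtain ⟨U, hU, hMP⟩ := Matrix.exists_unitary_mul_of_conjTranspose_mul_self_eq (M * P)
    ((Real.sqrt c : ℂ) • P) (by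
      rw [conjTranspose_mul, conjTranspose_smul, hP1, ← Matrix.mul_assoc, h, smul_mul_smul_comm,
        hP2, Complex.star_def, Complex.conj_ofReal, ← Complex.ofReal_mul, Real.mul_self_sqrt hc])
  exact ⟨U, hU, by rw [hMP, Matrix.mul_smul]⟩
end

section
/- Let P be an n×n complex orthogonal projector (P† = P and P·P = P), let M_1, …, M_K be n×n complex matrices, let c_1, …, c_K be nonnegative reals with P M_i† M_j P = c_i δ_{ij} P for all i, j, and let U_1, …, U_K be unitary matrices with M_i P = √c_i · U_i P for each i. Define P_i := U_i P U_i†. Then each P_i is an orthogonal projector, and for all i ≠ j with c_i ≠ 0 and c_j ≠ 0 one has P_i P_j = 0. -/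
open Matrix

/-- Distinct errors map the code space into mutually orthogonal subspaces:
the P_i := U_i P U_i† are orthogonal projectors with P_i P_j = 0 for i ≠ j
(when c_i, c_j ≠ 0). -/
theorem stmt_4 (n K : ℕ) (P : Matrix (Fin n) (Fin n) ℂ)
    (hP1 : Pᴴ = P) (hP2 : P * P = P)
    (M : Fin K → Matrix (Fin n) (Fin n) ℂ)
    (c : Fin K → ℝ) (hc : ∀ i, 0 ≤ c i)
    (hKL : ∀ i j, P * (M i)ᴴ * M j * P = (if i = j then (c i : ℂ) else 0) • P)
    (U : Fin K → Matrix (Fin n) (Fin n) ℂ)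
    (hU : ∀ i, U i ∈ Matrix.unitaryGroup (Fin n) ℂ)
    (hpolar : ∀ i, M i * P = (Real.sqrt (c i) : ℂ) • (U i * P)) :
    (∀ i, (U i * P * (U i)ᴴ)ᴴ = U i * P * (U i)ᴴ ∧
      (U i * P * (U i)ᴴ) * (U i * P * (U i)ᴴ) = U i * P * (U i)ᴴ) ∧
    ∀ i j, i ≠ j → c i ≠ 0 → c j ≠ 0 →
      (U i * P * (U i)ᴴ) * (U j * P * (U j)ᴴ) = 0 := by
  refine ⟨fun i => ⟨?_, ?_⟩, fun i j hij hi hj => ?_⟩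
  · simp [conjTranspose_mul, hP1, Matrix.mul_assoc]
  · have hUi : (U i)ᴴ * U i = 1 := Matrix.mem_unitaryGroup_iff'.mp (hU i)
    calc (U i * P * (U i)ᴴ) * (U i * P * (U i)ᴴ)
        = U i * P * ((U i)ᴴ * U i) * P * (U i)ᴴ := by simp only [Matrix.mul_assoc]
      _ = U i * (P * P) * (U i)ᴴ := by rw [hUi, Matrix.mul_one, Matrix.mul_assoc (U i)]
      _ = U i * P * (U i)ᴴ := by rw [hP2]
  · have sqrt_ne_zero : ∀ k, c k ≠ 0 → (Real.sqrt (c k) : ℂ) ≠ 0 := fun k hk =>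
      Complex.ofReal_ne_zero.mpr ((Real.sqrt_ne_zero (hc k)).mpr hk)
    have hM : (M i * P)ᴴ * (M j * P) = 0 := by
      have h := hKL i j
      rw [if_neg hij, zero_smul] at h
      rw [conjTranspose_mul, hP1, ← Matrix.mul_assoc, h]
    have hPUUP : P * (U i)ᴴ * (U j * P) = 0 := by
      rw [hpolar, hpolar, conjTranspose_smul, conjTranspose_mul, hP1, Matrix.smul_mul,
        Matrix.mul_smul] at hM
      exact (smul_eq_zero_iff_right (sqrt_ne_zero j hj)).mp
        ((smul_eq_zero_iff_right (star_ne_zero.mpr (sqrt_ne_zero i hi))).mp hM)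
    calc (U i * P * (U i)ᴴ) * (U j * P * (U j)ᴴ)
        = U i * (P * (U i)ᴴ * (U j * P)) * (U j)ᴴ := by simp only [Matrix.mul_assoc]
      _ = 0 := by rw [hPUUP, Matrix.mul_zero, Matrix.zero_mul]
end

section
/- Let P be a nonzero n×n complex orthogonal projector (P† = P and P·P = P) and let M_1, …, M_K be n×n complex matrices with Σ_i M_i† M_i = I. Suppose there exist nonnegative reals c_1, …, c_K such that P M_i† M_j P = c_i δ_{ij} P for all i, j. Then there exists a finite family of n×n matrices R_1, …, R_L with Σ_l R_l† R_l = I such that for every n×n matrix ρ one has Σ_{l=1}^{L} Σ_{i=1}^{K} R_l M_i (P ρ P) M_i† R_l† = P ρ P. -/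
open Matrix

/-- Sufficiency direction of the Knill–Laflamme theorem: if the conditions hold
in diagonal form, then a recovery channel (Kraus family {R_l}) exists which
restores every state supported in the code space. -/
theorem stmt_5 (n K : ℕ) (P : Matrix (Fin n) (Fin n) ℂ) (hP0 : P ≠ 0)
    (hP1 : Pᴴ = P) (hP2 : P * P = P)
    (M : Fin K → Matrix (Fin n) (Fin n) ℂ)
    (hsum : ∑ i, (M i)ᴴ * M i = 1)
    (c : Fin K → ℝ) (hc : ∀ i, 0 ≤ c i)
    (hKL : ∀ i j, P * (M i)ᴴ * M j * P = (if i = j then (c i : ℂ) else 0) • P) :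
    ∃ (L : ℕ) (R : Fin L → Matrix (Fin n) (Fin n) ℂ),
      (∑ l, (R l)ᴴ * R l = 1) ∧
      ∀ ρ : Matrix (Fin n) (Fin n) ℂ,
        ∑ l, ∑ i, R l * (M i * (P * ρ * P) * (M i)ᴴ) * (R l)ᴴ = P * ρ * P := by
  -- The syndrome measurement projects onto the mutually orthogonal images `M i P`.
  obtain ⟨a, ha⟩ : ∃ a : Fin K → ℝ, ∀ i, a i = (√(c i))⁻¹ := ⟨_, fun _ => rfl⟩
  have hsq : ∀ i, a i * a i = (c i)⁻¹ := fun i => by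
    rw [ha, ← mul_inv, Real.mul_self_sqrt (hc i)]
  have hzero : ∀ i, c i = 0 → M i * P = 0 := fun i hi => by
    open scoped ComplexOrder in apply Matrix.conjTranspose_mul_self_eq_zero.mp
    rw [conjTranspose_mul, hP1, ← Matrix.mul_assoc, hKL]
    simp [hi]
  obtain ⟨E, hE⟩ : ∃ E, E = ∑ i, ((a i * a i : ℝ) : ℂ) • (M i * P * (M i)ᴴ) := ⟨_, rfl⟩
  have hEM : ∀ i, E * (M i * P) = M i * P := fun i => by
    have hterm : ∀ j, ((a j * a j : ℝ) : ℂ) • (M j * P * (M j)ᴴ) * (M i * P)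
        = if j = i then M i * P else 0 := fun j => by
      have h : M j * P * (M j)ᴴ * (M i * P) = M j * (P * (M j)ᴴ * M i * P) := by
        simp only [Matrix.mul_assoc]
      rw [Matrix.smul_mul, h, hKL]
      split_ifs with hji
      · subst hji
        by_cases hcj : c j = 0
        · simp [hzero j hcj, hcj]
        · rw [Matrix.mul_smul, smul_smul, hsq, ← Complex.ofReal_mul, inv_mul_cancel₀ hcj]
          simp
      · simp
    rw [hE, Finset.sum_mul, Finset.sum_congr rfl fun j _ => hterm j]
    simp
  have hEH : Eᴴ = E := by
    simp [hE, conjTranspose_sum, conjTranspose_smul, hP1, Matrix.mul_assoc]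
  have hEE : E * E = E := by
    nth_rewrite 2 3 [hE]
    rw [Finset.mul_sum]
    refine Finset.sum_congr rfl fun i _ => ?_
    rw [Matrix.mul_smul, ← Matrix.mul_assoc, hEM]
  have hone : (∑ i, (c i : ℂ)) • P = P := by
    calc (∑ i, (c i : ℂ)) • P = ∑ i, P * ((M i)ᴴ * M i) * P := by
          rw [Finset.sum_smul]
          refine Finset.sum_congr rfl fun i _ => ?_
          rw [← Matrix.mul_assoc, hKL, if_pos rfl]
      _ = P := by rw [← Finset.sum_mul, ← Finset.mul_sum, hsum, Matrix.mul_one, hP2]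
  have hsandwich : ∀ R N ρ : Matrix (Fin n) (Fin n) ℂ,
      R * (N * (P * ρ * P) * Nᴴ) * Rᴴ = R * (N * P) * ρ * (R * (N * P))ᴴ := fun R N ρ => by
    simp only [conjTranspose_mul, hP1, Matrix.mul_assoc]
  refine ⟨K + 1, Fin.cons (1 - E) fun i => (a i : ℂ) • (P * (M i)ᴴ), ?_, fun ρ => ?_⟩
  · rw [Fin.sum_univ_succ]
    simp only [Fin.cons_zero, Fin.cons_succ]
    have hterm : ∀ i, ((a i : ℂ) • (P * (M i)ᴴ))ᴴ * ((a i : ℂ) • (P * (M i)ᴴ))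
        = ((a i * a i : ℝ) : ℂ) • (M i * P * (M i)ᴴ) := fun i => by
      have h : M i * P * (P * (M i)ᴴ) = M i * (P * P) * (M i)ᴴ := by
        simp only [Matrix.mul_assoc]
      rw [conjTranspose_smul, conjTranspose_mul, conjTranspose_conjTranspose, hP1,
        Matrix.smul_mul, Matrix.mul_smul, smul_smul, h, hP2, Complex.star_def,
        Complex.conj_ofReal, Complex.ofReal_mul]
    rw [Finset.sum_congr rfl fun i _ => hterm i, ← hE, conjTranspose_sub, hEH,
      conjTranspose_one, sub_mul, mul_sub, mul_sub, hEE]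
    simp
  · rw [Fin.sum_univ_succ]
    simp only [Fin.cons_zero, Fin.cons_succ, hsandwich]
    have hQ : ∀ i, (1 - E) * (M i * P) = 0 := fun i => by rw [sub_mul, hEM, one_mul, sub_self]
    have hterm : ∀ l i, (a l : ℂ) • (P * (M l)ᴴ) * (M i * P) * ρ
        * ((a l : ℂ) • (P * (M l)ᴴ) * (M i * P))ᴴ
        = if l = i then (c l : ℂ) • (P * ρ * P) else 0 := fun l i => by
      have h : (a l : ℂ) • (P * (M l)ᴴ) * (M i * P)
          = (a l : ℂ) • (if l = i then (c l : ℂ) else 0) • P := by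
        rw [← hKL, Matrix.smul_mul, ← Matrix.mul_assoc]
      rw [h]
      split_ifs with hli
      · have hcl : a l * c l * (a l * c l) = c l := by
          rw [mul_mul_mul_comm, hsq]
          by_cases h0 : c l = 0
          · simp [h0]
          · field_simp
        simp only [smul_smul, conjTranspose_smul, hP1, Matrix.smul_mul, Matrix.mul_smul]
        congr 1
        rw [← Complex.ofReal_mul, Complex.star_def, Complex.conj_ofReal, ← Complex.ofReal_mul, hcl]
      · simp
    simp only [hQ, hterm]
    simp only [zero_mul, Finset.sum_const_zero, zero_add, Finset.sum_ite_eq, Finset.mem_univ,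
      if_true]
    rw [← Finset.sum_smul, ← Matrix.smul_mul, ← Matrix.smul_mul, hone]
end

section
/- Let P be an n×n complex orthogonal projector (P† = P and P·P = P), let M_1, …, M_K and R_1, …, R_L be n×n complex matrices with Σ_l R_l† R_l = I, and suppose there exist complex numbers c_{lj} such that R_l M_j = c_{lj} P for all l, j. Then for all i, j one has P M_i† M_j P = α_{ij} P, where α_{ij} = Σ_l c_{lj} · conj(c_{li}), and the K×K matrix α = (α_{ij}) is Hermitian. -/
open Matrix

/-- Necessity direction computation of the Knill–Laflamme theorem: if each
R_l M_j is proportional to P (R_l M_j = c_{lj} P) with Σ_l R_l† R_l = I, then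
P M_i† M_j P = α_{ij} P with α_{ij} = Σ_l c_{lj} conj(c_{li}) Hermitian. -/
theorem stmt_6 (n K L : ℕ) (P : Matrix (Fin n) (Fin n) ℂ)
    (hP1 : Pᴴ = P) (hP2 : P * P = P)
    (M : Fin K → Matrix (Fin n) (Fin n) ℂ)
    (R : Fin L → Matrix (Fin n) (Fin n) ℂ)
    (hR : ∑ l, (R l)ᴴ * R l = 1)
    (c : Fin L → Fin K → ℂ)
    (hc : ∀ l j, R l * M j = c l j • P) :
    (∀ i j, P * (M i)ᴴ * M j * P = (∑ l, c l j * star (c l i)) • P) ∧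
    (Matrix.of fun i j : Fin K => ∑ l, c l j * star (c l i)).IsHermitian := by
  refine ⟨fun i j => ?_, ?_⟩
  · have h : (M i)ᴴ * M j = (∑ l, c l j * star (c l i)) • P := by
      calc (M i)ᴴ * M j = (M i)ᴴ * (∑ l, (R l)ᴴ * R l) * M j := by rw [hR, mul_one]
        _ = ∑ l, (R l * M i)ᴴ * (R l * M j) := by
          simp only [Finset.mul_sum, Finset.sum_mul, conjTranspose_mul, Matrix.mul_assoc]
        _ = (∑ l, c l j * star (c l i)) • P := by
          simp only [hc, conjTranspose_smul, hP1, smul_mul_smul_comm, hP2, Finset.sum_smul,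
            mul_comm]
    rw [Matrix.mul_assoc P, h, Matrix.mul_smul, Matrix.smul_mul, hP2, hP2]
  · ext i j
    simp [mul_comm]
end

section
/- Let P be an n×n complex orthogonal projector (P† = P and P·P = P) and let M_1, …, M_K be n×n complex matrices such that P M_i† M_j P = α_{ij} P for all i, j, where α = (α_{ij}) is a Hermitian K×K complex matrix. Then there exists a unitary K×K matrix u such that the matrices F_n := Σ_j u_{jn} M_j satisfy P F_m† F_n P = d_m δ_{mn} P for all m, n, where d_1, …, d_K are real numbers. -/
open Matrix

/-- Mixing a Kraus family by `u` conjugates its matrix of Knill–Laflamme coefficients by `u`. -/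
lemma compression_sum_smul {ι m R : Type*} [Fintype ι] [Fintype m] [CommRing R] [StarRing R]
    {P : Matrix m m R} {M : ι → Matrix m m R} {α : Matrix ι ι R}
    (h : ∀ i j, P * (M i)ᴴ * M j * P = α i j • P) (u : Matrix ι ι R) (a b : ι) :
    P * (∑ j, u j a • M j)ᴴ * (∑ j, u j b • M j) * P = (uᴴ * α * u) a b • P := by
  simp only [Matrix.conjTranspose_sum, Matrix.conjTranspose_smul, Matrix.mul_sum,
    Matrix.mul_smul, Matrix.smul_mul, h, Matrix.mul_apply, Matrix.conjTranspose_apply,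
    Finset.sum_mul, Finset.sum_smul, smul_smul]
  rw [Finset.sum_comm]
  refine Finset.sum_congr rfl fun j _ => Finset.sum_congr rfl fun i _ => ?_
  congr 1
  ring

/-- Diagonalization step of the Knill–Laflamme conditions: a Kraus family
satisfying them in Hermitian form can be replaced by a unitarily equivalent
family F_n = Σ_j u_{jn} M_j satisfying them in diagonal form. -/
theorem stmt_7 (n K : ℕ) (P : Matrix (Fin n) (Fin n) ℂ)
    (hP1 : Pᴴ = P) (hP2 : P * P = P)
    (M : Fin K → Matrix (Fin n) (Fin n) ℂ)
    (α : Matrix (Fin K) (Fin K) ℂ) (hα : α.IsHermitian)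
    (hKL : ∀ i j, P * (M i)ᴴ * M j * P = α i j • P) :
    ∃ u : Matrix (Fin K) (Fin K) ℂ, u ∈ Matrix.unitaryGroup (Fin K) ℂ ∧
      ∃ d : Fin K → ℝ,
        ∀ m' n' : Fin K,
          P * (∑ j, u j m' • M j)ᴴ * (∑ j, u j n' • M j) * P =
            (if m' = n' then (d m' : ℂ) else 0) • P := by
  refine ⟨hα.eigenvectorUnitary, hα.eigenvectorUnitary.2, hα.eigenvalues, fun a b => ?_⟩
  have hdiag := hα.conjStarAlgAut_star_eigenvectorUnitary
  rw [Unitary.conjStarAlgAut_star_apply, Matrix.star_eq_conjTranspose] at hdiag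
  rw [compression_sum_smul hKL, hdiag, Matrix.diagonal_apply]
  rfl
end

section
/- Let P be an n×n complex orthogonal projector (P† = P and P·P = P) and let M_1, …, M_K be n×n complex matrices such that P M_k† M_l P = α_{kl} P for all k, l, where α = (α_{kl}) is a Hermitian K×K complex matrix. For any complex coefficients c_{ik} (i = 1..K', k = 1..K) define E_i := Σ_k c_{ik} M_k. Then for all i, j one has P E_i† E_j P = β_{ij} P, where β_{ij} = Σ_{k,l} conj(c_{ik}) c_{jl} α_{kl}, and the matrix β = (β_{ij}) is Hermitian. -/
open Matrix

/-- Discretization of errors: if the Knill–Laflamme conditions hold for the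
operators {M_k}, then they hold (in Hermitian form) for arbitrary linear
combinations E_i = Σ_k c_{ik} M_k. -/
theorem stmt_8 (n K K' : ℕ) (P : Matrix (Fin n) (Fin n) ℂ)
    (hP1 : Pᴴ = P) (hP2 : P * P = P)
    (M : Fin K → Matrix (Fin n) (Fin n) ℂ)
    (α : Matrix (Fin K) (Fin K) ℂ) (hα : α.IsHermitian)
    (hKL : ∀ k l, P * (M k)ᴴ * M l * P = α k l • P)
    (c : Fin K' → Fin K → ℂ) :
    (∀ i j, P * (∑ k, c i k • M k)ᴴ * (∑ k, c j k • M k) * P =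
      (∑ k, ∑ l, star (c i k) * c j l * α k l) • P) ∧
    (Matrix.of fun i j : Fin K' => ∑ k, ∑ l, star (c i k) * c j l * α k l).IsHermitian := by
  constructor
  · intro i j
    simp only [conjTranspose_sum, conjTranspose_smul, Finset.mul_sum, Finset.sum_mul,
      Finset.sum_smul]
    rw [Finset.sum_comm]
    refine Finset.sum_congr rfl fun k _ => Finset.sum_congr rfl fun l _ => ?_
    rw [mul_smul (star (c i k) * c j l), ← hKL k l]
    simp only [Matrix.mul_smul, Matrix.smul_mul, smul_smul, mul_comm]
  · refine IsHermitian.ext fun i j => ?_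
    simp only [of_apply, star_sum, star_mul', star_star]
    rw [Finset.sum_comm]
    refine Finset.sum_congr rfl fun k _ => Finset.sum_congr rfl fun l _ => ?_
    rw [hα.apply k l, mul_comm (c j l)]
end
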